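/- In the finite MDP setting with discount factor γ ∈ (0,1), assume additionally that μ0(s) > 0 for every s ∈ S. If two policies π and π' satisfy ρ_π = ρ_{π'}, then π(a|s) = π'(a|s) for all (s,a) ∈ S×A; moreover, for every policy π, ∑_{a'∈A} ρ_π(s,a') > 0 for all s and π(a|s) = ρ_π(s,a) / ∑_{a'∈A} ρ_π(s,a'). -/

import Mathlib

/-- The time-`t` state distribution of policy `π` in the finite MDP with initial
distribution `μ0` and transition kernel `P`. -/
noncomputable def stateDist {S A : Type*} [Fintype S] [Fintype A]
    (μ0 : S → ℝ) (π : S → A → ℝ) (P : S → A → S → ℝ) : ℕ → S → ℝ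
  | 0 => μ0
  | t + 1 => fun s'' => ∑ s, ∑ a, stateDist μ0 π P t s * π s a * P s a s''

/-- The unnormalized (discounted) state distribution `μ_π(s) = ∑_t γ^t p_t(s)`. -/
noncomputable def muPi {S A : Type*} [Fintype S] [Fintype A]
    (γ : ℝ) (μ0 : S → ℝ) (π : S → A → ℝ) (P : S → A → S → ℝ) (s : S) : ℝ :=
  ∑' t : ℕ, γ ^ t * stateDist μ0 π P t s

/-- The occupancy measure `ρ_π(s,a) = π(a|s) μ_π(s)`. -/
noncomputable def occ {S A : Type*} [Fintype S] [Fintype A]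
    (γ : ℝ) (μ0 : S → ℝ) (π : S → A → ℝ) (P : S → A → S → ℝ) (s : S) (a : A) : ℝ :=
  π s a * muPi γ μ0 π P s

theorem stateDist_nonneg {S A : Type*} [Fintype S] [Fintype A]
    {μ0 : S → ℝ} {π : S → A → ℝ} {P : S → A → S → ℝ}
    (hμ0 : ∀ s, 0 ≤ μ0 s) (hπ : ∀ s a, 0 ≤ π s a) (hP : ∀ s a s', 0 ≤ P s a s')
    (t : ℕ) (s : S) : 0 ≤ stateDist μ0 π P t s := by
  induction t generalizing s with
  | zero => exact hμ0 s
  | succ t ih =>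
    exact Finset.sum_nonneg fun s' _ => Finset.sum_nonneg fun a _ =>
      mul_nonneg (mul_nonneg (ih s') (hπ s' a)) (hP s' a s)

theorem sum_stateDist {S A : Type*} [Fintype S] [Fintype A]
    {μ0 : S → ℝ} {π : S → A → ℝ} {P : S → A → S → ℝ}
    (hπsum : ∀ s, ∑ a, π s a = 1) (hPsum : ∀ s a, ∑ s', P s a s' = 1) (t : ℕ) :
    ∑ s, stateDist μ0 π P t s = ∑ s, μ0 s := by
  induction t with
  | zero => rfl
  | succ t ih =>
    rw [← ih]
    simp only [stateDist]
    rw [Finset.sum_comm]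
    refine Finset.sum_congr rfl fun s _ => ?_
    rw [Finset.sum_comm]
    simp only [← Finset.mul_sum, hPsum, hπsum, mul_one]

/-- The discounted series defining `muPi` converges. -/
theorem summable_discounted_stateDist {S A : Type*} [Fintype S] [Fintype A]
    {γ : ℝ} {μ0 : S → ℝ} {π : S → A → ℝ} {P : S → A → S → ℝ}
    (hγ0 : 0 ≤ γ) (hγ1 : γ < 1) (hμ0 : ∀ s, 0 ≤ μ0 s)
    (hπ : ∀ s a, 0 ≤ π s a) (hπsum : ∀ s, ∑ a, π s a = 1)
    (hP : ∀ s a s', 0 ≤ P s a s') (hPsum : ∀ s a, ∑ s', P s a s' = 1) (s : S) :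
    Summable fun t : ℕ => γ ^ t * stateDist μ0 π P t s := by
  refine Summable.of_nonneg_of_le
    (fun t => mul_nonneg (pow_nonneg hγ0 t) (stateDist_nonneg hμ0 hπ hP t s)) (fun t => ?_)
    ((summable_geometric_of_lt_one hγ0 hγ1).mul_right (∑ s, μ0 s))
  rw [← sum_stateDist hπsum hPsum t]
  exact mul_le_mul_of_nonneg_left
    (Finset.single_le_sum (fun s' _ => stateDist_nonneg hμ0 hπ hP t s') (Finset.mem_univ s))
    (pow_nonneg hγ0 t)

theorem muPi_pos {S A : Type*} [Fintype S] [Fintype A]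
    {γ : ℝ} {μ0 : S → ℝ} {π : S → A → ℝ} {P : S → A → S → ℝ}
    (hγ0 : 0 ≤ γ) (hγ1 : γ < 1) (hμ0 : ∀ s, 0 < μ0 s)
    (hπ : ∀ s a, 0 ≤ π s a) (hπsum : ∀ s, ∑ a, π s a = 1)
    (hP : ∀ s a s', 0 ≤ P s a s') (hPsum : ∀ s a, ∑ s', P s a s' = 1) (s : S) :
    0 < muPi γ μ0 π P s := by
  have hμ0' s := (hμ0 s).le
  refine (summable_discounted_stateDist hγ0 hγ1 hμ0' hπ hπsum hP hPsum s).tsum_pos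
    (fun t => mul_nonneg (pow_nonneg hγ0 t) (stateDist_nonneg hμ0' hπ hP t s)) 0 ?_
  simpa [stateDist] using hμ0 s

theorem sum_occ {S A : Type*} [Fintype S] [Fintype A]
    {γ : ℝ} {μ0 : S → ℝ} {π : S → A → ℝ} {P : S → A → S → ℝ}
    (hπsum : ∀ s, ∑ a, π s a = 1) (s : S) :
    ∑ a, occ γ μ0 π P s a = muPi γ μ0 π P s := by
  simp only [occ, ← Finset.sum_mul, hπsum, one_mul]

/-- Proposition 3.1, one-to-one correspondence: with `μ0 > 0` everywhere, two
policies with the same occupancy measure coincide; moreover for any policy `π`,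
`∑_{a'} ρ_π(s,a') > 0` and `π(a|s) = ρ_π(s,a) / ∑_{a'} ρ_π(s,a')`. -/
theorem occ_injective_and_policy_recovery {S A : Type*} [Fintype S] [Fintype A]
    [Nonempty S] [Nonempty A]
    (γ : ℝ) (hγ0 : 0 < γ) (hγ1 : γ < 1)
    (μ0 : S → ℝ) (hμ0pos : ∀ s, 0 < μ0 s) (hμ0sum : ∑ s, μ0 s = 1)
    (P : S → A → S → ℝ) (hP : ∀ s a s', 0 ≤ P s a s')
    (hPsum : ∀ s a, ∑ s', P s a s' = 1)
    (π π' : S → A → ℝ)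
    (hπ : ∀ s a, 0 ≤ π s a) (hπsum : ∀ s, ∑ a, π s a = 1)
    (hπ' : ∀ s a, 0 ≤ π' s a) (hπ'sum : ∀ s, ∑ a, π' s a = 1)
    (hocc : ∀ s a, occ γ μ0 π P s a = occ γ μ0 π' P s a) :
    (∀ s a, π s a = π' s a) ∧
    (∀ s, 0 < ∑ a', occ γ μ0 π P s a') ∧
    (∀ s a, π s a = occ γ μ0 π P s a / ∑ a', occ γ μ0 π P s a') := by
  have pos := muPi_pos hγ0.le hγ1 hμ0pos hπ hπsum hP hPsum
  have muPi_eq s : muPi γ μ0 π P s = muPi γ μ0 π' P s := by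
    rw [← sum_occ hπsum, ← sum_occ hπ'sum]
    exact Finset.sum_congr rfl fun a _ => hocc s a
  refine ⟨fun s a => ?_, fun s => ?_, fun s a => ?_⟩
  · have h := hocc s a
    simp only [occ, ← muPi_eq] at h
    exact mul_right_cancel₀ (pos s).ne' h
  · rw [sum_occ hπsum]
    exact pos s
  · rw [sum_occ hπsum, occ, mul_div_cancel_right₀ _ (pos s).ne']
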